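/- Fix an integer m ≥ 2. Let f : ℕ → ℝ be strictly positive and let γ > 0 be such that lim_{n→∞} f(n)/f(n+1) = γ, ∑_{n≥0} γ^n f(n) < ∞, and there exists a finite constant C₁(m) such that (max_{⌈n/m⌉ ≤ k ≤ n} γ^k f(k)) / (min_{⌈n/m⌉ ≤ k ≤ n} γ^k f(k)) ≤ C₁(m) for all n ≥ 1. Then for every fixed η ∈ X_{m-1}, lim_{n→∞} ∑_{η' ∈ X_{m-1}, |η'| ≤ n(1−1/m)} K_{m-1,n}(η') f(η'_1)⋯f(η'_{m-1}) · f(n−|η'|)/f(n−|η|) = ∑_{η' ∈ X_{m-1}} m K_{m-1}(η') γ^{|η'|−|η|} f(η'_1)⋯f(η'_{m-1}), and the limiting sum is finite. -/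

import Mathlib

open Filter Topology

noncomputable section

/-- The order operator `𝔒`: rearrange the coordinates of a configuration in
nondecreasing order. -/
def ord {m : ℕ} (ξ : Fin m → ℕ) : Fin m → ℕ := ξ ∘ Tuple.sort ξ

/-- The cut operator `ℭ`: delete the last coordinate of a configuration. -/
def cut {m : ℕ} (ξ : Fin m → ℕ) : Fin (m - 1) → ℕ :=
  fun i => ξ (Fin.castLE (Nat.sub_le m 1) i)

/-- `K_k(ζ)`: the number of configurations of `ℕ^k` whose ordering is `ζ`. -/
def K {k : ℕ} (ζ : Fin k → ℕ) : ℕ := Nat.card {ξ : Fin k → ℕ // ord ξ = ζ}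

/-- `K_{m-1,n}(η)`: the number of configurations of `ℕ^m` with `n` particles whose
ordering followed by cutting gives `η`. -/
def Kn (m n : ℕ) (η : Fin (m - 1) → ℕ) : ℕ :=
  Nat.card {ξ : Fin m → ℕ // (∑ j, ξ j) = n ∧ cut (ord ξ) = η}

/-- The canonical measure `ν_{m,n}`, i.e. the grand canonical measure conditioned on
configurations with `n` particles. -/
def nu (f : ℕ → ℝ) (m n : ℕ) (ξ : Fin m → ℕ) : ℝ :=
  if (∑ j, ξ j) = n then
    (∏ j, f (ξ j)) / ∑' ξ' : {ξ' : Fin m → ℕ // (∑ j, ξ' j) = n}, ∏ j, f (ξ'.1 j)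
  else 0

/-- The grand canonical measure `μ_{m,φ}`. -/
def mu (f : ℕ → ℝ) (m : ℕ) (φ : ℝ) (ξ : Fin m → ℕ) : ℝ :=
  (∏ j, φ ^ (ξ j) * f (ξ j)) / (∑' k : ℕ, φ ^ k * f k) ^ m

/-- The ordered-and-cut canonical measure `ν̂_{m-1,n} = ν_{m,n} ∘ (ℭ ∘ 𝔒)⁻¹`. -/
def nuHat (f : ℕ → ℝ) (m n : ℕ) (η : Fin (m - 1) → ℕ) : ℝ :=
  ∑' ξ : {ξ : Fin m → ℕ // (∑ j, ξ j) = n ∧ cut (ord ξ) = η}, nu f m n ξ.1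

/-- The ordered grand canonical measure `μ̂_{k,φ} = μ_{k,φ} ∘ 𝔒⁻¹`. -/
def muHat (f : ℕ → ℝ) (k : ℕ) (φ : ℝ) (ζ : Fin k → ℕ) : ℝ :=
  ∑' ξ : {ξ : Fin k → ℕ // ord ξ = ζ}, mu f k φ ξ.1

/-- The multiset of coordinates. -/
def ms {k : ℕ} (ξ : Fin k → ℕ) : Multiset ℕ := Finset.univ.val.map ξ

theorem ord_mono {k : ℕ} (ξ : Fin k → ℕ) : Monotone (ord ξ) := Tuple.monotone_sort ξ

theorem ms_ord {k : ℕ} (ξ : Fin k → ℕ) : ms (ord ξ) = ms ξ := by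
  unfold ms ord
  rw [Fin.univ_val_map, Fin.univ_val_map]
  exact Multiset.coe_eq_coe.2 ((Tuple.sort ξ).ofFn_comp_perm ξ)

theorem eq_of_ms {k : ℕ} {ξ ζ : Fin k → ℕ} (h1 : Monotone ξ) (h2 : Monotone ζ)
    (h : ms ξ = ms ζ) : ξ = ζ := by
  unfold ms at h
  rw [Fin.univ_val_map, Fin.univ_val_map] at h
  exact List.ofFn_injective ((Multiset.coe_eq_coe.1 h).eq_of_pairwise'
      h1.sortedLE_ofFn.pairwise h2.sortedLE_ofFn.pairwise)

theorem ord_eq_iff {k : ℕ} {ξ ζ : Fin k → ℕ} (h2 : Monotone ζ) :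
    ord ξ = ζ ↔ ms ξ = ms ζ := by
  constructor
  · rintro rfl; exact (ms_ord ξ).symm
  · intro h; exact eq_of_ms (ord_mono ξ) h2 ((ms_ord ξ).trans h)

theorem ms_succAbove {k : ℕ} (ξ : Fin (k+1) → ℕ) (i : Fin (k+1)) :
    ms ξ = ξ i ::ₘ ms (fun j => ξ (i.succAbove j)) := by
  unfold ms
  rw [Fin.univ_succAbove k i]
  simp [Function.comp_def]

theorem ms_sum {k : ℕ} (ξ : Fin k → ℕ) : (ms ξ).sum = ∑ j, ξ j := rfl

theorem ord_sum {k : ℕ} (ξ : Fin k → ℕ) : ∑ j, ord ξ j = ∑ j, ξ j := by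
  rw [← ms_sum, ← ms_sum, ms_ord]

theorem finite_ord {k : ℕ} (ζ : Fin k → ℕ) :
    Finite {ξ : Fin k → ℕ // ord ξ = ζ} ∧ Nat.card {ξ : Fin k → ℕ // ord ξ = ζ} ≤ k.factorial := by
  have hs : Function.Injective
      (fun x : {ξ : Fin k → ℕ // ord ξ = ζ} => Tuple.sort x.1) := by
    rintro ⟨x, hx⟩ ⟨y, hy⟩ h
    have h' : Tuple.sort x = Tuple.sort y := h
    have : x ∘ Tuple.sort x = y ∘ Tuple.sort x := by
      conv_rhs => rw [h']
      exact hx.trans hy.symm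
    apply Subtype.ext
    funext i
    have := congrFun this ((Tuple.sort x).symm i)
    simpa using this
  refine ⟨Finite.of_injective _ hs, ?_⟩
  have := Nat.card_le_card_of_injective _ hs
  rwa [Nat.card_perm, Nat.card_fin] at this

theorem cut_ord_iff {k n : ℕ} (η : Fin k → ℕ) (ξ : Fin (k+1) → ℕ) :
    ((∑ j, ξ j) = n ∧ cut (ord ξ) = η) →
      ord ξ = Fin.snoc (α := fun _ => ℕ) η (n - ∑ i, η i) := by
  rintro ⟨h1, h2⟩
  have h3 := ord_sum ξ
  rw [Fin.sum_univ_castSucc] at h3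
  have h4 : ∀ i : Fin k, ord ξ i.castSucc = η i := fun i => congrFun h2 i
  simp only [h4] at h3
  funext i
  refine Fin.lastCases ?_ (fun i => ?_) i
  · simp; omega
  · simp [h4]

theorem Kn_le (k n : ℕ) (η : Fin k → ℕ) : Kn (k+1) n η ≤ (k+1).factorial := by
  obtain ⟨h1, h2⟩ := finite_ord (Fin.snoc (α := fun _ => ℕ) η (n - ∑ i, η i) : Fin (k+1) → ℕ)
  refine le_trans ?_ h2
  exact Nat.card_le_card_of_injective
    (fun x => ⟨x.1, cut_ord_iff η x.1 x.2⟩) (by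
      rintro ⟨x, hx⟩ ⟨y, hy⟩ h
      simpa using h)

theorem Kn_eq (k n : ℕ) (η : Fin k → ℕ) (hη : Monotone η) (hn : 2 * (∑ i, η i) < n) :
    Kn (k+1) n η = (k+1) * K η := by
  set a := n - ∑ i, η i with ha
  have hle : ∀ i, η i < a := by
    intro i
    have := Finset.single_le_sum (f := η) (fun _ _ => Nat.zero_le _) (Finset.mem_univ i)
    omega
  have hmono : Monotone (Fin.snoc (α := fun _ => ℕ) η a : Fin (k+1) → ℕ) := by
    rw [Fin.monotone_iff_le_succ] 
    intro i
    simp only [Fin.snoc_castSucc]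
    rcases Nat.lt_or_ge (i.1+1) k with h | h
    · have : i.succ = Fin.castSucc ⟨i.1+1, h⟩ := by ext; simp
      rw [this, Fin.snoc_castSucc]
      exact hη (by simp [Fin.le_def])
    · have : i.succ = Fin.last k := by ext; simp; omega
      rw [this, Fin.snoc_last]
      exact (hle i).le
  have hms : ms (Fin.snoc (α := fun _ => ℕ) η a : Fin (k+1) → ℕ) = a ::ₘ ms η := by
    rw [ms_succAbove _ (Fin.last k)]; simp
  have hlt : ∀ ξ : Fin k → ℕ, ord ξ = η → ∀ i, ξ i < a := by
    intro ξ h i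
    rw [ord_eq_iff hη] at h
    have : ξ i ∈ ms η := by
      rw [← h]; unfold ms; simp
    unfold ms at this
    simp at this
    obtain ⟨j, hj⟩ := this
    rw [← hj]; exact hle j
  have key : ∀ (i : Fin (k+1)) (ξ : Fin k → ℕ), ord ξ = η →
      (∑ j, (Fin.insertNth (α := fun _ => ℕ) i a ξ : Fin (k+1) → ℕ) j) = n ∧
        cut (ord (Fin.insertNth (α := fun _ => ℕ) i a ξ : Fin (k+1) → ℕ)) = η := by
    intro i ξ h
    constructor
    · rw [Fin.sum_insertNth, ← ord_sum ξ, h]; omega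
    · have : ord (Fin.insertNth (α := fun _ => ℕ) i a ξ : Fin (k+1) → ℕ)
          = Fin.snoc (α := fun _ => ℕ) η a := by
        rw [ord_eq_iff hmono, hms, ms_succAbove _ i]
        simp only [Fin.insertNth_apply_same, Fin.insertNth_apply_succAbove]
        rw [(ord_eq_iff hη).1 h]
      rw [this]
      funext j
      exact Fin.snoc_castSucc (α := fun _ => ℕ) (n := k) a η j
  unfold Kn K
  have hcard : (k+1) * Nat.card {ξ : Fin k → ℕ // ord ξ = η} =
      Nat.card (Fin (k+1) × {ξ : Fin k → ℕ // ord ξ = η}) := by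
    rw [Nat.card_prod, Nat.card_fin]
  refine Eq.trans ?_ hcard.symm
  symm
  refine Nat.card_eq_of_bijective
    (fun p : Fin (k+1) × {ξ : Fin k → ℕ // ord ξ = η} =>
      (⟨Fin.insertNth (α := fun _ => ℕ) p.1 a p.2.1, key p.1 p.2.1 p.2.2⟩ :
        {ξ : Fin (k+1) → ℕ // (∑ j, ξ j) = n ∧ cut (ord ξ) = η})) ⟨?_, ?_⟩
  · rintro ⟨i, x, hx⟩ ⟨j, y, hy⟩ h
    have h' : (Fin.insertNth (α := fun _ => ℕ) i a x : Fin (k+1) → ℕ)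
      = Fin.insertNth (α := fun _ => ℕ) j a y := congrArg Subtype.val h
    have hij : i = j := by
      by_contra hne
      obtain ⟨l, hl⟩ := Fin.exists_succAbove_eq hne
      have := congrFun h' i
      rw [Fin.insertNth_apply_same, ← hl, Fin.insertNth_apply_succAbove] at this
      have := hlt y hy l
      omega
    subst hij
    have hxy : x = y := by
      funext l
      have := congrFun h' (i.succAbove l)
      simpa using this
    subst hxy
    rfl
  · rintro ⟨ξ, hξ⟩
    have h1 := cut_ord_iff η ξ hξ
    rw [ord_eq_iff hmono, hms] at h1
    have : a ∈ ms ξ := by rw [h1]; simp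
    unfold ms at this
    obtain ⟨i, -, hi⟩ := Multiset.mem_map.1 this
    rw [ms_succAbove ξ i, hi, Multiset.cons_inj_right, ← ord_eq_iff hη] at h1
    refine ⟨(i, ⟨_, h1⟩), ?_⟩
    apply Subtype.ext
    funext j
    refine Fin.succAboveCases i ?_ (fun l => ?_) j
    · simp [hi]
    · simp

theorem summable_pi (g : ℕ → ℝ) (hg : ∀ n, 0 ≤ g n) (hs : Summable g) (k : ℕ) :
    Summable (fun ξ : Fin k → ℕ => ∏ i, g (ξ i)) := by
  induction k with
  | zero => exact (hasSum_fintype _).summable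
  | succ k ih =>
    rw [← (Fin.consEquiv (fun _ : Fin (k+1) => ℕ)).summable_iff]
    have := hs.mul_of_nonneg ih hg (fun ξ => Finset.prod_nonneg fun i _ => hg _)
    refine this.congr fun p => ?_
    simp [Fin.prod_univ_succ, Fin.consEquiv]

theorem ratio_lim (f : ℕ → ℝ) (hfpos : ∀ n, 0 < f n) (γ : ℝ)
    (hratio : Tendsto (fun n => f n / f (n + 1)) atTop (𝓝 γ)) (a : ℕ) :
    Tendsto (fun n => f (n - a) / f n) atTop (𝓝 (γ ^ a)) := by
  rw [← tendsto_add_atTop_iff_nat a]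
  simp only [Nat.add_sub_cancel]
  induction a with
  | zero => simp [fun n => div_self (hfpos n).ne']
  | succ a ih =>
    have := ih.mul ((tendsto_add_atTop_iff_nat a).2 hratio)
    rw [pow_succ]
    refine this.congr fun n => ?_
    have h1 := (hfpos (n+a)).ne'
    have h2 := (hfpos (n+a+1)).ne'
    rw [← add_assoc]
    field_simp

theorem ratio_lim2 (f : ℕ → ℝ) (hfpos : ∀ n, 0 < f n) (γ : ℝ) (hγ : 0 < γ)
    (hratio : Tendsto (fun n => f n / f (n + 1)) atTop (𝓝 γ)) (a b : ℕ) :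
    Tendsto (fun n => f (n - a) / f (n - b)) atTop (𝓝 (γ ^ a / γ ^ b)) := by
  refine ((ratio_lim f hfpos γ hratio a).div (ratio_lim f hfpos γ hratio b)
    (pow_pos hγ b).ne').congr fun n => ?_
  have h1 := (hfpos n).ne'
  have h2 := (hfpos (n-b)).ne'
  simp only [Pi.div_apply]
  field_simp

theorem ceil_le {k n s : ℕ} (h : (k+1) * s ≤ k * n) : s ≤ n ∧ (n + (k+1) - 1) / (k+1) ≤ n - s := by
  have hs : s ≤ n := by
    by_contra hc
    push Not at hc
    nlinarith
  refine ⟨hs, ?_⟩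
  obtain ⟨t, rfl⟩ := Nat.exists_eq_add_of_le hs
  rw [← Nat.lt_succ_iff, Nat.div_lt_iff_lt_mul (by omega)]
  simp only [Nat.add_sub_cancel_left, Nat.succ_eq_add_one]
  have : s + t + (k+1) - 1 = s + t + k := by omega
  rw [this]
  nlinarith

/-- The key limit (a5) in the proof of Theorem 1: under hypotheses (a2) and (a6),
for every fixed monotone `η ∈ X_{m-1}`,
`∑_{η' ∈ X_{m-1}, |η'| ≤ n(1-1/m)} K_{m-1,n}(η') f(η'_1)⋯f(η'_{m-1}) f(n-|η'|)/f(n-|η|)`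
converges, as `n → ∞`, to
`∑_{η' ∈ X_{m-1}} m K_{m-1}(η') γ^{|η'|-|η|} f(η'_1)⋯f(η'_{m-1})`,
and the limiting sum is finite. -/
theorem key_limit
    (m : ℕ) (hm : 2 ≤ m)
    (f : ℕ → ℝ) (hfpos : ∀ n, 0 < f n)
    (γ : ℝ) (hγ : 0 < γ)
    (hratio : Tendsto (fun n => f n / f (n + 1)) atTop (𝓝 γ))
    (hsum : Summable fun n => γ ^ n * f n)
    (C₁ : ℝ)
    (hC₁ : ∀ n : ℕ, 1 ≤ n → ∀ k l : ℕ,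
      (n + m - 1) / m ≤ k → k ≤ n → (n + m - 1) / m ≤ l → l ≤ n →
      (γ ^ k * f k) / (γ ^ l * f l) ≤ C₁)
    (η : Fin (m - 1) → ℕ) (hη : Monotone η) :
    Summable (fun η' : {η' : Fin (m - 1) → ℕ // Monotone η'} =>
      (m * K η'.1 : ℝ) * (γ ^ (∑ i, η'.1 i) / γ ^ (∑ i, η i)) * ∏ i, f (η'.1 i)) ∧
    Tendsto
      (fun n => ∑' η' : {η' : Fin (m - 1) → ℕ //
          Monotone η' ∧ m * (∑ i, η' i) ≤ (m - 1) * n},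
        (Kn m n η'.1 : ℝ) * (∏ i, f (η'.1 i)) *
          (f (n - ∑ i, η'.1 i) / f (n - ∑ i, η i)))
      atTop
      (𝓝 (∑' η' : {η' : Fin (m - 1) → ℕ // Monotone η'},
        (m * K η'.1 : ℝ) * (γ ^ (∑ i, η'.1 i) / γ ^ (∑ i, η i)) *
          ∏ i, f (η'.1 i))) := by
  obtain ⟨k, rfl⟩ : ∃ k, m = k + 1 := ⟨m - 1, by omega⟩
  change Fin k → ℕ at η
  have hk : 1 ≤ k := by omega
  have hC : 0 < C₁ := by
    have h := hC₁ 1 le_rfl 1 1 (by simp) le_rfl (by simp) le_rfl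
    rw [div_self (by have := hfpos 1; positivity)] at h
    linarith
  have hP : ∀ ξ : Fin k → ℕ, 0 < ∏ i, f (ξ i) := fun ξ => Finset.prod_pos fun i _ => hfpos _
  -- basic summable function
  have hS0 : Summable (fun ξ : Fin k → ℕ =>
      γ ^ (∑ i, ξ i) / γ ^ (∑ i, η i) * ∏ i, f (ξ i)) := by
    have := (summable_pi (fun n => γ ^ n * f n)
      (fun n => by have := hfpos n; positivity) hsum k).div_const (γ ^ (∑ i, η i))
    refine this.congr fun ξ => ?_
    rw [Finset.prod_mul_distrib, Finset.prod_pow_eq_pow_sum]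
    ring
  set B : (Fin k → ℕ) → ℝ := fun ξ => γ ^ (∑ i, ξ i) / γ ^ (∑ i, η i) * ∏ i, f (ξ i) with hB
  have hBpos : ∀ ξ, 0 ≤ B ξ := fun ξ => by have := hP ξ; simp only [hB]; positivity
  constructor
  · refine Summable.of_nonneg_of_le (f := fun η' : {η' : Fin k → ℕ // Monotone η'} =>
      (((k+1 : ℕ) : ℝ) * k.factorial) * B η'.1) (fun η' => ?_) (fun η' => ?_)
      ((hS0.subtype _).mul_left _)
    · have := hP η'.1
      positivity
    · have h1 : (K η'.1 : ℝ) ≤ k.factorial := by exact_mod_cast (finite_ord η'.1).2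
      have h2 := hBpos η'.1
      rw [mul_assoc]
      change _ * B η'.1 ≤ _
      gcongr
  · have e1 : ∀ n, (∑' η' : {η' : Fin k → ℕ //
          Monotone η' ∧ (k+1) * (∑ i, η' i) ≤ (k+1-1) * n},
        (Kn (k+1) n η'.1 : ℝ) * (∏ i, f (η'.1 i)) *
          (f (n - ∑ i, η'.1 i) / f (n - ∑ i, η i))) =
        ∑' η' : Fin k → ℕ, Set.indicator {η' : Fin k → ℕ |
          Monotone η' ∧ (k+1) * (∑ i, η' i) ≤ (k+1-1) * n}
          (fun η' => (Kn (k+1) n η' : ℝ) * (∏ i, f (η' i)) *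
          (f (n - ∑ i, η' i) / f (n - ∑ i, η i))) η' := fun n =>
        tsum_subtype {η' : Fin k → ℕ | Monotone η' ∧ (k+1) * (∑ i, η' i) ≤ (k+1-1) * n}
          (fun η' => (Kn (k+1) n η' : ℝ) * (∏ i, f (η' i)) *
          (f (n - ∑ i, η' i) / f (n - ∑ i, η i)))
    have e2 : (∑' η' : {η' : Fin k → ℕ // Monotone η'},
        (((k+1 : ℕ) : ℝ) * K η'.1) * (γ ^ (∑ i, η'.1 i) / γ ^ (∑ i, η i)) *
          ∏ i, f (η'.1 i)) = ∑' η' : Fin k → ℕ, Set.indicator {η' : Fin k → ℕ | Monotone η'}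
          (fun η' => (((k+1 : ℕ) : ℝ) * K η') * (γ ^ (∑ i, η' i) / γ ^ (∑ i, η i)) *
          ∏ i, f (η' i)) η' := tsum_subtype {η' : Fin k → ℕ | Monotone η'}
          (fun η' => (((k+1 : ℕ) : ℝ) * K η') * (γ ^ (∑ i, η' i) / γ ^ (∑ i, η i)) *
          ∏ i, f (η' i))
    refine (tendsto_congr e1).2 ?_
    refine Eq.subst (motive := fun x => Tendsto _ atTop (𝓝 x)) e2.symm ?_
    refine tendsto_tsum_of_dominated_convergence
      (bound := fun ξ => ((k+1).factorial * C₁) * B ξ) (hS0.mul_left _) ?_ ?_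
    · intro ξ
      by_cases hξ : Monotone ξ
      · rw [Set.indicator_of_mem (by exact hξ)]
        have hl := ((ratio_lim2 f hfpos γ hγ hratio (∑ i, ξ i) (∑ i, η i)).const_mul
          ((((k+1 : ℕ) : ℝ) * K ξ) * ∏ i, f (ξ i)))
        have : (((k+1 : ℕ) : ℝ) * K ξ) * (γ ^ (∑ i, ξ i) / γ ^ (∑ i, η i)) * ∏ i, f (ξ i)
          = (((k+1 : ℕ) : ℝ) * K ξ) * (∏ i, f (ξ i)) * (γ ^ (∑ i, ξ i) / γ ^ (∑ i, η i)) := by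
          ring
        rw [this]
        refine hl.congr' ?_
        filter_upwards [eventually_gt_atTop (2 * ∑ i, ξ i),
          eventually_ge_atTop ((k+1) * ∑ i, ξ i)] with n h1 h2
        have h3 : (k+1) * (∑ i, ξ i) ≤ (k+1-1) * n := by
          simp only [Nat.add_sub_cancel]; nlinarith
        rw [Set.indicator_of_mem (by exact ⟨hξ, h3⟩), Kn_eq k n ξ hξ h1]
        push_cast; rfl
      · rw [Set.indicator_of_notMem (by exact hξ)]
        refine tendsto_const_nhds.congr fun n => ?_
        rw [Set.indicator_of_notMem (by exact fun h => hξ h.1)]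
    · filter_upwards [eventually_ge_atTop 1, eventually_ge_atTop ((k+1) * ∑ i, η i)] with n hn h2 ξ
      by_cases hξ : Monotone ξ ∧ (k+1) * (∑ i, ξ i) ≤ (k+1-1) * n
      · rw [Set.indicator_of_mem (by exact hξ)]
        have hη3 : (k+1) * (∑ i, η i) ≤ k * n := by nlinarith
        have hξ3 := hξ.2
        simp only [Nat.add_sub_cancel] at hξ3
        obtain ⟨a1, a2⟩ := ceil_le hη3
        obtain ⟨b1, b2⟩ := ceil_le hξ3
        have h := hC₁ n hn _ _ b2 (Nat.sub_le _ _) a2 (Nat.sub_le _ _)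
        have hp := hP ξ
        have hf1 := hfpos (n - ∑ i, ξ i)
        have hf2 := hfpos (n - ∑ i, η i)
        have hK : (Kn (k+1) n ξ : ℝ) ≤ (k+1).factorial := by exact_mod_cast Kn_le k n ξ
        rw [Real.norm_of_nonneg (by positivity)]
        have hr : f (n - ∑ i, ξ i) / f (n - ∑ i, η i)
            ≤ C₁ * (γ ^ (∑ i, ξ i) / γ ^ (∑ i, η i)) := by
          have e : f (n - ∑ i, ξ i) / f (n - ∑ i, η i) =
            (γ ^ (n - ∑ i, ξ i) * f (n - ∑ i, ξ i)) / (γ ^ (n - ∑ i, η i) * f (n - ∑ i, η i))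
              * (γ ^ (∑ i, ξ i) / γ ^ (∑ i, η i)) := by
            have q1 : γ ^ (n - ∑ i, ξ i) * γ ^ (∑ i, ξ i) = γ ^ n := by
              rw [← pow_add, Nat.sub_add_cancel b1]
            have q2 : γ ^ (n - ∑ i, η i) * γ ^ (∑ i, η i) = γ ^ n := by
              rw [← pow_add, Nat.sub_add_cancel a1]
            rw [div_mul_div_comm, mul_right_comm, q1, mul_right_comm, q2,
              mul_div_mul_left _ _ (pow_pos hγ n).ne']
          rw [e]
          gcongr
        calc _ ≤ ((k+1).factorial : ℝ) * (∏ i, f (ξ i)) *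
              (C₁ * (γ ^ (∑ i, ξ i) / γ ^ (∑ i, η i))) := by gcongr
          _ = _ := by simp only [hB]; ring
      · rw [Set.indicator_of_notMem (by exact hξ), norm_zero]
        have := hBpos ξ
        positivity

end
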